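/- arXiv:1702.08122 — 2 statements merged into one kernel-verified Lean document; each statement's English description precedes it below -/
import Mathlib

section
/- Let c > 0, α > 0, β ≥ 0, and r ∈ (0, 1], and let X be a positive random variable with cumulative distribution function F(u) = exp(-c·u^{-1/α}) for u > 0. Then E[exp(-β·X^{-r/α})] ≥ exp(-β·Γ(1 + r)·c^{-r}), where Γ is the Gamma function. -/
open Real Set MeasureTheory ProbabilityTheory

/-- The fractional moment of order `r` of an exponential variable of rate `c`, computed from its
upper tail. -/
theorem lintegral_rpow_of_exponential_tail
    {Ω : Type*} [MeasurableSpace Ω] {μ : Measure Ω} {c r : ℝ} (hc : 0 < c) (hr : 0 < r)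
    {Y : Ω → ℝ} (hY : Measurable Y) (hYnonneg : ∀ ω, 0 ≤ Y ω)
    (htail : ∀ t : ℝ, 0 < t → μ {ω | t ≤ Y ω} = ENNReal.ofReal (Real.exp (-(c * t)))) :
    ∫⁻ ω, ENNReal.ofReal (Y ω ^ r) ∂μ = ENNReal.ofReal (Real.Gamma (1 + r) * c ^ (-r)) := by
  have hΓ := Real.integral_rpow_mul_exp_neg_mul_Ioi hr hc
  have hint : IntegrableOn (fun t : ℝ => t ^ (r - 1) * Real.exp (-(c * t))) (Ioi 0) := by
    refine Integrable.of_integral_ne_zero ?_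
    rw [hΓ]
    have := Real.Gamma_pos_of_pos hr
    positivity
  rw [lintegral_rpow_eq_lintegral_meas_le_mul μ (Filter.Eventually.of_forall hYnonneg)
    hY.aemeasurable hr]
  have htail_mul : ∫⁻ t in Ioi (0 : ℝ), μ {ω | t ≤ Y ω} * ENNReal.ofReal (t ^ (r - 1)) =
      ∫⁻ t in Ioi (0 : ℝ), ENNReal.ofReal (t ^ (r - 1) * Real.exp (-(c * t))) := by
    refine setLIntegral_congr_fun measurableSet_Ioi fun t ht => ?_
    have ht : 0 < t := ht
    rw [htail t ht, mul_comm, ENNReal.ofReal_mul (by positivity)]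
  rw [htail_mul, ← ofReal_integral_eq_lintegral_ofReal hint, hΓ, ← ENNReal.ofReal_mul hr.le,
    add_comm, Real.Gamma_add_one hr.ne', one_div, Real.inv_rpow hc.le, Real.rpow_neg hc.le]
  · ring_nf
  · filter_upwards [ae_restrict_mem measurableSet_Ioi] with t ht
    have ht : 0 < t := ht
    simp only [Pi.zero_apply]
    positivity

/-- Jensen's inequality for the Laplace transform of a nonnegative random variable. -/
theorem exp_neg_mul_integral_le_integral_exp_neg_mul
    {Ω : Type*} [MeasurableSpace Ω] {μ : Measure Ω} [IsProbabilityMeasure μ]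
    {β : ℝ} (hβ : 0 ≤ β) {V : Ω → ℝ} (hV : Integrable V μ) (hVnonneg : ∀ ω, 0 ≤ V ω) :
    Real.exp (-β * ∫ ω, V ω ∂μ) ≤ ∫ ω, Real.exp (-β * V ω) ∂μ := by
  have hexp : Integrable (fun ω => Real.exp (-β * V ω)) μ := by
    refine (integrable_const (1 : ℝ)).mono'
      (Real.continuous_exp.comp_aestronglyMeasurable (hV.aestronglyMeasurable.const_mul (-β)))
      (Filter.Eventually.of_forall fun ω => ?_)
    rw [Real.norm_eq_abs, Real.abs_exp, Real.exp_le_one_iff]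
    nlinarith [mul_nonneg hβ (hVnonneg ω)]
  rw [← integral_const_mul]
  exact convexOn_exp.map_integral_le Real.continuous_exp.continuousOn isClosed_univ
    (Filter.Eventually.of_forall fun _ => mem_univ _) (hV.const_mul (-β)) hexp

/-- Jensen lower bound for the cross-street interference: if `X > 0` has CDF
`F(u) = exp(-c·u^{-1/α})` for `u > 0` and `r ∈ (0,1]`, then
`E[exp(-β·X^{-r/α})] ≥ exp(-β·Γ(1+r)·c^{-r})`. -/
theorem frechet_laplace_jensen_lower_bound_fractional
    {Ω : Type*} [MeasurableSpace Ω] (μ : Measure Ω) [IsProbabilityMeasure μ]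
    (c α β r : ℝ) (hc : 0 < c) (hα : 0 < α) (hβ : 0 ≤ β) (hr : r ∈ Ioc (0 : ℝ) 1)
    (X : Ω → ℝ) (hX : Measurable X) (hXpos : ∀ ω, 0 < X ω)
    (hcdf : ∀ u : ℝ, 0 < u →
      μ {ω | X ω ≤ u} = ENNReal.ofReal (Real.exp (-c * u ^ (-(1 / α))))) :
    Real.exp (-β * Real.Gamma (1 + r) * c ^ (-r)) ≤
      ∫ ω, Real.exp (-β * X ω ^ (-(r / α))) ∂μ := by
  have hαinv : -(1 / α) < 0 := neg_lt_zero.mpr (one_div_pos.mpr hα)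
  have htail : ∀ t : ℝ, 0 < t →
      μ {ω | t ≤ X ω ^ (-(1 / α))} = ENNReal.ofReal (Real.exp (-(c * t))) := by
    intro t ht
    have hu : 0 < t ^ (-α) := Real.rpow_pos_of_pos ht _
    have hut : (t ^ (-α)) ^ (-(1 / α)) = t := by
      rw [← Real.rpow_mul ht.le, neg_mul_neg, mul_one_div_cancel hα.ne', Real.rpow_one]
    have hset : {ω | t ≤ X ω ^ (-(1 / α))} = {ω | X ω ≤ t ^ (-α)} := by
      ext ω
      rw [mem_ofPred_eq, mem_ofPred_eq, ← Real.rpow_le_rpow_iff_of_neg hu (hXpos ω) hαinv, hut]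
    rw [hset, hcdf _ hu, hut, neg_mul]
  have hpow : ∀ ω, (X ω ^ (-(1 / α))) ^ r = X ω ^ (-(r / α)) := fun ω => by
    rw [← Real.rpow_mul (hXpos ω).le]
    ring_nf
  have hVnonneg : ∀ ω, 0 ≤ X ω ^ (-(r / α)) := fun ω => Real.rpow_nonneg (hXpos ω).le _
  have hVmeas : Measurable fun ω => X ω ^ (-(r / α)) := hX.pow_const _
  have hmoment := lintegral_rpow_of_exponential_tail hc hr.1 (hX.pow_const (-(1 / α)))
    (fun ω => Real.rpow_nonneg (hXpos ω).le _) htail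
  simp only [hpow] at hmoment
  have hV : Integrable (fun ω => X ω ^ (-(r / α))) μ := by
    refine ⟨hVmeas.aestronglyMeasurable, ?_⟩
    rw [hasFiniteIntegral_iff_ofReal (Filter.Eventually.of_forall hVnonneg), hmoment]
    exact ENNReal.ofReal_lt_top
  have hΓ : 0 < Real.Gamma (1 + r) := Real.Gamma_pos_of_pos (by linarith [hr.1])
  have hmean : ∫ ω, X ω ^ (-(r / α)) ∂μ = Real.Gamma (1 + r) * c ^ (-r) := by
    rw [integral_eq_lintegral_of_nonneg_ae (Filter.Eventually.of_forall hVnonneg)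
      hVmeas.aestronglyMeasurable, hmoment, ENNReal.toReal_ofReal (by positivity)]
  rw [mul_assoc, ← hmean]
  exact exp_neg_mul_integral_le_integral_exp_neg_mul hβ hV hVnonneg
end

section
/- Let 0 < α_L < α_N, let γ_T, γ_C, λ_B > 0, and set r = α_L/α_N. Let u_T and u_C be independent positive random variables with cumulative distribution functions F_T(u) = exp(-γ_T·λ_B·u^{-1/α_L}) and F_C(u) = exp(-γ_C·λ_B^{r}·u^{-1/α_N}) for u > 0, respectively. Then P(u_C < u_T) = γ_T · ∫₀^∞ exp(-γ_C·x^{r} - γ_T·x) dx. In particular, this probability does not depend on λ_B. -/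
open Real Set MeasureTheory ProbabilityTheory

lemma expMeasure_Ioi {r x : ℝ} (hr : 0 < r) (hx : 0 ≤ x) :
    expMeasure r (Ioi x) = ENNReal.ofReal (exp (-(r * x))) := by
  have := isProbabilityMeasure_expMeasure hr
  have h1 : 0 ≤ 1 - exp (-(r * x)) := by
    have : exp (-(r * x)) ≤ 1 := exp_le_one_iff.2 (neg_nonpos.2 (by positivity))
    linarith
  rw [← compl_Iic, prob_compl_eq_one_sub measurableSet_Iic, ← ofReal_cdf, cdf_expMeasure_eq hr,
    if_pos hx, ← ENNReal.ofReal_one, ← ENNReal.ofReal_sub _ h1, sub_sub_cancel]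

lemma expMeasure_Ici {r : ℝ} (hr : 0 < r) (x : ℝ) :
    expMeasure r (Ici x) = if 0 ≤ x then ENNReal.ofReal (exp (-(r * x))) else 1 := by
  have := isProbabilityMeasure_expMeasure hr
  have : NullSingletonClass (expMeasure r) :=
    nullSingletonClass_withDensity _
  rw [measure_congr Ioi_ae_eq_Ici.symm]
  split_ifs with hx
  · exact expMeasure_Ioi hr hx
  · rw [← compl_Iic, prob_compl_eq_one_sub measurableSet_Iic, ← ofReal_cdf,
      cdf_expMeasure_eq hr, if_neg hx]
    simp

/-- A negative power of a Fréchet-distributed random variable is exponentially distributed. -/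
lemma map_const_mul_rpow_eq_expMeasure {Ω : Type*} [MeasurableSpace Ω] {μ : Measure Ω}
    [IsProbabilityMeasure μ] {b c s : ℝ} (hb : 0 < b) (hc : 0 < c) (hs : s < 0)
    {U : Ω → ℝ} (hU : Measurable U) (hUpos : ∀ ω, 0 < U ω)
    (hcdf : ∀ u : ℝ, 0 < u → μ {ω | U ω ≤ u} = ENNReal.ofReal (exp (-c * b * u ^ s))) :
    μ.map (fun ω ↦ b * U ω ^ s) = expMeasure c := by
  have hmeas : Measurable (fun ω ↦ b * U ω ^ s) := by fun_prop
  have := Measure.isProbabilityMeasure_map (μ := μ) hmeas.aemeasurable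
  refine Measure.ext_of_Ici _ _ fun a ↦ ?_
  rw [Measure.map_apply hmeas measurableSet_Ici, expMeasure_Ici hc]
  rcases le_or_gt a 0 with ha | ha
  · have hpre : (fun ω ↦ b * U ω ^ s) ⁻¹' Ici a = univ :=
      eq_univ_of_forall fun ω ↦ ha.trans (mul_pos hb (rpow_pos_of_pos (hUpos ω) s)).le
    rw [hpre, measure_univ]
    split_ifs with h
    · simp [le_antisymm ha h]
    · rfl
  · have hv : 0 < (a / b) ^ s⁻¹ := by positivity
    have hvs : ((a / b) ^ s⁻¹) ^ s = a / b := rpow_inv_rpow (by positivity) hs.ne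
    have hpre : (fun ω ↦ b * U ω ^ s) ⁻¹' Ici a = {ω | U ω ≤ (a / b) ^ s⁻¹} := by
      ext ω
      rw [mem_preimage, mem_Ici, mem_ofPred_eq, ← rpow_le_rpow_iff_of_neg hv (hUpos ω) hs, hvs,
        div_le_iff₀' hb]
    rw [hpre, hcdf _ hv, hvs, if_pos ha.le]
    congr 2
    field_simp

lemma integral_expMeasure {r : ℝ} (hr : 0 < r) (g : ℝ → ℝ) :
    ∫ x, g x ∂(expMeasure r) = r * ∫ x in Ioi (0 : ℝ), exp (-(r * x)) * g x := by
  have hpdf : Measurable (gammaPDF 1 r) := (measurable_gammaPDFReal 1 r).ennreal_ofReal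
  rw [expMeasure, gammaMeasure, integral_withDensity_eq_integral_toReal_smul hpdf
    (ae_of_all _ fun _ ↦ ENNReal.ofReal_lt_top), ← integral_const_mul,
    ← integral_Ici_eq_integral_Ioi, ← integral_indicator measurableSet_Ici]
  congr 1 with x
  change (exponentialPDF r x).toReal • g x = _
  rw [exponentialPDF_eq]
  by_cases hx : 0 ≤ x
  · rw [if_pos hx, ENNReal.toReal_ofReal (by positivity), indicator_of_mem (mem_Ici.2 hx),
      smul_eq_mul, mul_assoc]
  · simp [hx]

/-- Corollary 1 of the paper: the probability of association with a typical (same-street)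
base station is `P(u_C < u_T) = γ_T · ∫₀^∞ exp(-γ_C·x^r - γ_T·x) dx`, independent of `λ_B`. -/
theorem typical_association_probability
    {Ω : Type*} [MeasurableSpace Ω] (μ : Measure Ω) [IsProbabilityMeasure μ]
    (αL αN γT γC lamB : ℝ) (hαL : 0 < αL) (hαN : αL < αN)
    (hγT : 0 < γT) (hγC : 0 < γC) (hlamB : 0 < lamB)
    (uT uC : Ω → ℝ) (huT : Measurable uT) (huC : Measurable uC)
    (huTpos : ∀ ω, 0 < uT ω) (huCpos : ∀ ω, 0 < uC ω)
    (hIndep : IndepFun uT uC μ)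
    (hcdfT : ∀ u : ℝ, 0 < u →
      μ {ω | uT ω ≤ u} = ENNReal.ofReal (Real.exp (-γT * lamB * u ^ (-(1 / αL)))))
    (hcdfC : ∀ u : ℝ, 0 < u →
      μ {ω | uC ω ≤ u} =
        ENNReal.ofReal (Real.exp (-γC * lamB ^ (αL / αN) * u ^ (-(1 / αN))))) :
    (μ {ω | uC ω < uT ω}).toReal =
      γT * ∫ x in Ioi (0 : ℝ), Real.exp (-γC * x ^ (αL / αN) - γT * x) := by
  have hN : 0 < αN := hαL.trans hαN
  have hsT : -(1 / αL) < 0 := neg_neg_of_pos (by positivity)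
  have hsC : -(1 / αN) < 0 := neg_neg_of_pos (by positivity)
  set r := αL / αN with hr
  have hmT : Measurable (fun u : ℝ ↦ lamB * u ^ (-(1 / αL))) := by fun_prop
  have hmC : Measurable (fun u : ℝ ↦ lamB ^ r * u ^ (-(1 / αN))) := by fun_prop
  have hlawT : μ.map (fun ω ↦ lamB * uT ω ^ (-(1 / αL))) = expMeasure γT :=
    map_const_mul_rpow_eq_expMeasure hlamB hγT hsT huT huTpos hcdfT
  have hlawC : μ.map (fun ω ↦ lamB ^ r * uC ω ^ (-(1 / αN))) = expMeasure γC :=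
    map_const_mul_rpow_eq_expMeasure (by positivity) hγC hsC huC huCpos hcdfC
  have hprod : μ.map (fun ω ↦ (lamB * uT ω ^ (-(1 / αL)), lamB ^ r * uC ω ^ (-(1 / αN)))) =
      (expMeasure γT).prod (expMeasure γC) := by
    rw [← hlawT, ← hlawC]
    exact (hIndep.comp hmT hmC).map_prod_eq_prod_map_map (hmT.comp huT).aemeasurable
      (hmC.comp huC).aemeasurable
  have hmeas : Measurable
      (fun ω ↦ (lamB * uT ω ^ (-(1 / αL)), lamB ^ r * uC ω ^ (-(1 / αN)))) := by fun_prop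
  have := isProbabilityMeasure_expMeasure hγT
  have := isProbabilityMeasure_expMeasure hγC
  have hS : MeasurableSet {p : ℝ × ℝ | p.1 ^ r < p.2} :=
    measurableSet_lt (by fun_prop) (by fun_prop)
  have hevent : {ω | uC ω < uT ω} =
      (fun ω ↦ (lamB * uT ω ^ (-(1 / αL)), lamB ^ r * uC ω ^ (-(1 / αN)))) ⁻¹'
        {p : ℝ × ℝ | p.1 ^ r < p.2} := by
    ext ω
    have hexp : -(1 / αL) * r = -(1 / αN) := by rw [hr]; field_simp
    simp only [mem_ofPred_eq, mem_preimage]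
    rw [mul_rpow hlamB.le (rpow_nonneg (huTpos ω).le _), ← rpow_mul (huTpos ω).le, hexp,
      mul_lt_mul_iff_right₀ (rpow_pos_of_pos hlamB r),
      rpow_lt_rpow_iff_of_neg (huTpos ω) (huCpos ω) hsC]
  rw [hevent, ← Measure.map_apply hmeas hS, hprod,
    Measure.prod_apply hS, ← integral_toReal (measurable_measure_prodMk_left hS).aemeasurable
      (ae_of_all _ fun _ ↦ measure_lt_top _ _), integral_expMeasure hγT]
  congr 1
  refine setIntegral_congr_fun measurableSet_Ioi fun x (hx : 0 < x) ↦ ?_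
  change exp (-(γT * x)) * (expMeasure γC (Ioi (x ^ r))).toReal = _
  rw [expMeasure_Ioi hγC (by positivity), ENNReal.toReal_ofReal (exp_pos _).le, ← exp_add]
  congr 1
  ring
end
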